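/- arXiv:math/0212085 — 2 statements merged into one kernel-verified Lean document; each statement's English description precedes it below -/
import Mathlib

section
/- The 𝒪_F-lattice K := {x₁ + w·x₂ : x₁ ∈ L, x₂ ∈ L^#} in V ⊗_ℚ F is unimodular: its dual with respect to the extended bilinear form equals K itself, i.e., {y ∈ V ⊗_ℚ F : B_F(y, z) ∈ 𝒪_F for all z ∈ K} = K. -/
open scoped TensorProduct

noncomputable section

/-- The discriminant of `ℚ(√N)` for squarefree `N`. -/
def discN (N : ℕ) : ℕ := if N % 4 = 1 then N else 4 * N

/-- `√Δ` as an element of `F = ℚ(α)` with `α² = N`. -/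
def sqrtDisc {F : Type*} [Field F] (N : ℕ) (α : F) : F :=
  if N % 4 = 1 then α else 2 * α

/-- The generator `w = (Δ + √Δ)/2` of `𝒪_F = ℤ + ℤw`. -/
def wQ {F : Type*} [Field F] (N : ℕ) (α : F) : F :=
  ((discN N : F) + sqrtDisc N α) / 2

/-- The dual lattice `L^# = {y ∈ V : B(y, L) ⊆ ℤ}`. -/
def dualLat {V : Type*} [AddCommGroup V] [Module ℚ V] (Q : QuadraticForm ℚ V)
    (L : Submodule ℤ V) : Set V :=
  {y | ∀ x ∈ L, ∃ m : ℤ, QuadraticMap.polar (⇑Q) y x = (m : ℚ)}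

/-- The `𝒪_F`-lattice `K = {x₁ + w·x₂ : x₁ ∈ L, x₂ ∈ L^#}` inside `F ⊗_ℚ V`. -/
def Klat {F : Type*} [Field F] [CharZero F] (N : ℕ) (α : F) {V : Type*}
    [AddCommGroup V] [Module ℚ V] (Q : QuadraticForm ℚ V) (L : Submodule ℤ V) :
    Set (F ⊗[ℚ] V) :=
  {y | ∃ x₁ ∈ L, ∃ x₂ ∈ dualLat Q L, y = (1 : F) ⊗ₜ[ℚ] x₁ + wQ N α ⊗ₜ[ℚ] x₂}

section QuadraticGenerator

variable {F : Type*} [Field F] [CharZero F] {N : ℕ} {α : F}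

/-- The minimal equation of `w`: both of its coefficients are divisible by `N`. -/
theorem wQ_mul_self (hα : α ^ 2 = (N : F)) :
    ∃ t n : ℤ, wQ N α * wQ N α = (N : F) * ((n : F) + (t : F) * wQ N α) := by
  unfold wQ discN sqrtDisc
  split_ifs with h
  · obtain ⟨k, hk⟩ : ∃ k, N = 4 * k + 1 := ⟨N / 4, by omega⟩
    refine ⟨1, -k, ?_⟩
    have hk' : (N : F) = 4 * k + 1 := by rw [hk]; push_cast; ring
    push_cast
    rw [hk'] at hα ⊢
    linear_combination (1 / 4 : F) * hα
  · refine ⟨4, 1 - 4 * N, ?_⟩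
    push_cast
    linear_combination hα

theorem exists_eq_add_mul_wQ (hgen : ∀ x : F, ∃ p q : ℚ, x = (p : F) + (q : F) * α) (x : F) :
    ∃ p q : ℚ, x = (p : F) + (q : F) * wQ N α := by
  obtain ⟨p, q, rfl⟩ := hgen x
  unfold wQ discN sqrtDisc
  split_ifs
  · exact ⟨p - N * q, 2 * q, by push_cast; ring⟩
  · exact ⟨p - 2 * N * q, q, by push_cast; ring⟩

theorem eq_zero_of_add_mul_eq_zero (hN : 1 < N) (hsf : Squarefree N) (hα : α ^ 2 = (N : F))
    {p q : ℚ} (h : (p : F) + (q : F) * α = 0) : p = 0 ∧ q = 0 := by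
  have hq : q = 0 := by
    by_contra hq
    have hq' : (q : F) ≠ 0 := by exact_mod_cast hq
    have hαq : α = ((-p / q : ℚ) : F) := by
      push_cast
      field_simp
      linear_combination h
    have hsq : IsSquare (N : ℚ) := by
      refine ⟨-p / q, ?_⟩
      have : ((N : ℚ) : F) = ((-p / q * (-p / q) : ℚ) : F) := by
        rw [Rat.cast_mul, ← hαq, Rat.cast_natCast, ← hα, sq]
      exact_mod_cast this
    obtain ⟨a, rfl⟩ := Rat.isSquare_natCast_iff.1 hsq
    have := Nat.isUnit_iff.1 (hsf a dvd_rfl)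
    simp [this] at hN
  subst hq
  simpa using h

theorem eq_of_add_mul_wQ_eq (hN : 1 < N) (hsf : Squarefree N) (hα : α ^ 2 = (N : F))
    {p q p' q' : ℚ} (h : (p : F) + (q : F) * wQ N α = p' + q' * wQ N α) : p = p' ∧ q = q' := by
  unfold wQ discN sqrtDisc at h
  split_ifs at h
  · have := eq_zero_of_add_mul_eq_zero (p := p - p' + (q - q') * N / 2) (q := (q - q') / 2)
      hN hsf hα (by push_cast; linear_combination h)
    have hq : q = q' := by linarith [this.2]
    subst hq
    exact ⟨by linarith [this.1], rfl⟩
  · have := eq_zero_of_add_mul_eq_zero (p := p - p' + (q - q') * (2 * N)) (q := q - q')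
      hN hsf hα (by push_cast at h ⊢; linear_combination h)
    have hq : q = q' := by linarith [this.2]
    subst hq
    exact ⟨by linarith [this.1], rfl⟩

theorem exists_eq_tmul_add_wQ_tmul {V : Type*} [AddCommGroup V] [Module ℚ V]
    (hgen : ∀ x : F, ∃ p q : ℚ, x = (p : F) + (q : F) * α) (y : F ⊗[ℚ] V) :
    ∃ y₁ y₂ : V, y = (1 : F) ⊗ₜ[ℚ] y₁ + wQ N α ⊗ₜ[ℚ] y₂ := by
  induction y with
  | zero => exact ⟨0, 0, by simp⟩
  | tmul a v =>
    obtain ⟨p, q, rfl⟩ := exists_eq_add_mul_wQ (N := N) hgen a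
    refine ⟨p • v, q • v, ?_⟩
    rw [← TensorProduct.smul_tmul, ← TensorProduct.smul_tmul, TensorProduct.add_tmul,
      Rat.smul_def, Rat.smul_def, mul_one]
  | add a b ha hb =>
    obtain ⟨a₁, a₂, rfl⟩ := ha
    obtain ⟨b₁, b₂, rfl⟩ := hb
    refine ⟨a₁ + b₁, a₂ + b₂, ?_⟩
    rw [TensorProduct.tmul_add, TensorProduct.tmul_add]
    abel

end QuadraticGenerator

section DualLattice

open LinearMap (BilinForm)

variable {V : Type*} [AddCommGroup V] [Module ℚ V]

theorem nondegenerate_polarBilin {Q : QuadraticForm ℚ V} (hQ : Q.PosDef) :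
    (QuadraticMap.polarBilin Q : BilinForm ℚ V).Nondegenerate := by
  have key : ∀ x, QuadraticMap.polar Q x x = 0 → x = 0 := fun x hx ↦ by
    refine hQ.anisotropic x ?_
    rw [QuadraticMap.polar_self] at hx
    simpa using hx
  exact ⟨fun x hx ↦ key x (hx x), fun x hx ↦ key x (hx x)⟩

/-- A full submodule on which the form takes integral values is finitely generated. -/
theorem fg_of_le_dualSubmodule [FiniteDimensional ℚ V] {B : BilinForm ℚ V}
    (hB : B.Nondegenerate) {L : Submodule ℤ V} (hfull : Submodule.span ℚ (L : Set V) = ⊤)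
    (hL : L ≤ B.dualSubmodule L) : L.FG := by
  classical
  let b := Module.Basis.ofSpan hfull.ge
  have hb : Set.range b ⊆ L := Module.Basis.ofSpan_subset hfull.ge
  have := Module.Finite.finite_basis b
  have hle : L ≤ Submodule.span ℤ (Set.range (B.dualBasis hB b)) := by
    rw [← LinearMap.BilinForm.dualSubmodule_span_of_basis]
    exact fun x hx y hy ↦ hL hx y (Submodule.span_le.2 hb hy)
  exact Submodule.FG.of_le (Submodule.fg_span (Set.finite_range _)) hle

theorem dualSubmodule_dualSubmodule_of_isLattice {B : BilinForm ℚ V}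
    (hB : B.Nondegenerate) (hs : B.IsSymm) (L : Submodule ℤ V) [L.IsLattice ℚ] :
    B.dualSubmodule (B.dualSubmodule L) = L := by
  have := Submodule.IsLattice.free ℚ L
  let b := Module.Free.chooseBasis ℤ L
  have hspan : Submodule.span ℤ (Set.range (b.extendOfIsLattice ℚ)) = L := by
    have : Set.range (b.extendOfIsLattice ℚ) = L.subtype '' Set.range b := by
      ext; simp
    rw [this, ← Submodule.map_span, b.span_eq, Submodule.map_top, Submodule.range_subtype]
  have h := LinearMap.BilinForm.dualSubmodule_dualSubmodule_of_basis (R := ℤ) B hB hs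
    (b.extendOfIsLattice ℚ)
  rwa [hspan] at h

theorem mem_dualSubmodule_polarBilin {Q : QuadraticForm ℚ V} {L : Submodule ℤ V} {y : V} :
    y ∈ BilinForm.dualSubmodule (QuadraticMap.polarBilin Q) L ↔ y ∈ dualLat Q L := by
  simp [LinearMap.BilinForm.mem_dualSubmodule, dualLat, Submodule.mem_one, eq_comm]

theorem le_dualSubmodule_polarBilin {Q : QuadraticForm ℚ V} {L : Submodule ℤ V}
    (hint : ∀ x ∈ L, ∃ m : ℤ, Q x = (m : ℚ)) :
    L ≤ BilinForm.dualSubmodule (QuadraticMap.polarBilin Q) L := by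
  intro x hx
  rw [mem_dualSubmodule_polarBilin]
  intro y hy
  obtain ⟨a, ha⟩ := hint _ (L.add_mem hx hy)
  obtain ⟨b, hb⟩ := hint _ hx
  obtain ⟨c, hc⟩ := hint _ hy
  exact ⟨a - b - c, by rw [QuadraticMap.polar, ha, hb, hc]; push_cast; ring⟩

/-- An integral positive definite full lattice is its own double dual. -/
theorem mem_of_forall_polar_dualLat [FiniteDimensional ℚ V] {Q : QuadraticForm ℚ V}
    (hQ : Q.PosDef) {L : Submodule ℤ V} (hfull : Submodule.span ℚ (L : Set V) = ⊤)
    (hint : ∀ x ∈ L, ∃ m : ℤ, Q x = (m : ℚ)) {y : V}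
    (hy : ∀ x ∈ dualLat Q L, ∃ m : ℤ, QuadraticMap.polar Q y x = (m : ℚ)) : y ∈ L := by
  have hB := nondegenerate_polarBilin hQ
  have hs : BilinForm.IsSymm (QuadraticMap.polarBilin Q) :=
    ⟨fun x y ↦ QuadraticMap.polar_comm Q x y⟩
  have : L.IsLattice ℚ :=
    ⟨fg_of_le_dualSubmodule hB hfull (le_dualSubmodule_polarBilin hint), hfull⟩
  rw [← dualSubmodule_dualSubmodule_of_isLattice hB hs L, mem_dualSubmodule_polarBilin]
  exact fun x hx ↦ hy x (mem_dualSubmodule_polarBilin.1 hx)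

/-- `N` times the form is integral on the dual lattice. -/
theorem exists_natCast_mul_polar_dualLat {N : ℕ} (hN : N ≠ 0) {Q : QuadraticForm ℚ V}
    {L : Submodule ℤ V} (hsub : ∀ y ∈ dualLat Q L, ∃ x ∈ L, y = (N : ℚ)⁻¹ • x)
    {y z : V} (hy : y ∈ dualLat Q L) (hz : z ∈ dualLat Q L) :
    ∃ m : ℤ, (N : ℚ) * QuadraticMap.polar Q y z = (m : ℚ) := by
  obtain ⟨x, hx, rfl⟩ := hsub z hz
  obtain ⟨m, hm⟩ := hy x hx
  refine ⟨m, ?_⟩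
  have : (N : ℚ) ≠ 0 := by exact_mod_cast hN
  rw [QuadraticMap.polar_smul_right, smul_eq_mul, mul_inv_cancel_left₀ this, hm]

theorem zero_mem_dualLat (Q : QuadraticForm ℚ V) (L : Submodule ℤ V) : (0 : V) ∈ dualLat Q L :=
  fun x _ ↦ ⟨0, by simp⟩

end DualLattice

theorem polar_baseChange_tmul_add {F : Type*} [Field F] [CharZero F] {V : Type*}
    [AddCommGroup V] [Module ℚ V] (Q : QuadraticForm ℚ V) {w : F} {N t n : F}
    (hw : w * w = N * (n + t * w)) (y₁ y₂ x₁ x₂ : V) :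
    QuadraticMap.polar (Q.baseChange F) ((1 : F) ⊗ₜ[ℚ] y₁ + w ⊗ₜ[ℚ] y₂)
        ((1 : F) ⊗ₜ[ℚ] x₁ + w ⊗ₜ[ℚ] x₂) =
      (((QuadraticMap.polar Q y₁ x₁ : ℚ) : F) + n * (N * (QuadraticMap.polar Q y₂ x₂ : ℚ))) +
      (((QuadraticMap.polar Q y₂ x₁ : ℚ) : F) + (QuadraticMap.polar Q y₁ x₂ : ℚ)
        + t * (N * (QuadraticMap.polar Q y₂ x₂ : ℚ))) * w := by
  have htmul (a b : F) (u v : V) : QuadraticMap.polar (Q.baseChange F) (a ⊗ₜ u) (b ⊗ₜ v) =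
      ((QuadraticMap.polar Q u v : ℚ) : F) * (a * b) := by
    rw [← QuadraticMap.polarBilin_apply_apply, QuadraticForm.polarBilin_baseChange,
      LinearMap.BilinForm.baseChange_tmul, QuadraticMap.polarBilin_apply_apply, Rat.smul_def]
  simp only [QuadraticMap.polar_add_left, QuadraticMap.polar_add_right, htmul]
  linear_combination ((QuadraticMap.polar Q y₂ x₂ : ℚ) : F) * hw

/-- The `𝒪_F`-lattice `K` is unimodular: its dual with respect to the extended
bilinear form `B_F` (the polar form of the base extension `q_F`) equals `K`. -/
theorem stmt12 {F : Type*} [Field F] [CharZero F] (N : ℕ) (hN : 1 < N)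
    (hsf : Squarefree N) (α : F) (hα : α ^ 2 = (N : F))
    (hgen : ∀ x : F, ∃ p q : ℚ, x = (p : F) + (q : F) * α)
    {V : Type*} [AddCommGroup V] [Module ℚ V] [FiniteDimensional ℚ V]
    (Q : QuadraticForm ℚ V) (hQpos : QuadraticMap.PosDef Q)
    (L : Submodule ℤ V) (hfull : Submodule.span ℚ (L : Set V) = ⊤)
    (hint : ∀ x ∈ L, ∃ m : ℤ, Q x = (m : ℚ))
    (hNdual : ∀ y ∈ dualLat Q L, ∃ m : ℤ, (N : ℚ) * Q y = (m : ℚ))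
    (hsub : ∀ y ∈ dualLat Q L, ∃ x ∈ L, y = (N : ℚ)⁻¹ • x) :
    {y : F ⊗[ℚ] V | ∀ z ∈ Klat N α Q L,
        ∃ m n : ℤ, QuadraticMap.polar (⇑(Q.baseChange F)) y z =
          (m : F) + (n : F) * wQ N α} = Klat N α Q L := by
  obtain ⟨t, n, hw⟩ := wQ_mul_self hα
  have hpolar := polar_baseChange_tmul_add Q hw
  have hcoord (p q : ℚ) (h : ∃ m n : ℤ, (p : F) + q * wQ N α = m + n * wQ N α) :
      (∃ m : ℤ, p = m) ∧ ∃ m : ℤ, q = m := by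
    obtain ⟨m, n, h⟩ := h
    obtain ⟨hp, hq⟩ := eq_of_add_mul_wQ_eq (p' := m) (q' := n) hN hsf hα (by exact_mod_cast h)
    exact ⟨⟨m, hp⟩, n, hq⟩
  ext y
  refine ⟨fun hy ↦ ?_, ?_⟩
  · obtain ⟨y₁, y₂, rfl⟩ := exists_eq_tmul_add_wQ_tmul (N := N) hgen y
    have hy₂ : y₂ ∈ dualLat Q L := fun x hx ↦ by
      have h := hy _ ⟨x, hx, 0, zero_mem_dualLat Q L, rfl⟩
      rw [hpolar] at h
      exact (hcoord (QuadraticMap.polar Q y₁ x) _ (by simpa using h)).2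
    refine ⟨y₁, mem_of_forall_polar_dualLat hQpos hfull hint fun x hx ↦ ?_, y₂, hy₂, rfl⟩
    have h := hy _ ⟨0, L.zero_mem, x, hx, rfl⟩
    rw [hpolar] at h
    obtain ⟨k, hk⟩ := exists_natCast_mul_polar_dualLat (by omega) hsub hy₂ hx
    obtain ⟨m, hm⟩ := (hcoord (n * (N * QuadraticMap.polar Q y₂ x))
      (QuadraticMap.polar Q y₁ x + t * (N * QuadraticMap.polar Q y₂ x)) (by simpa using h)).2
    refine ⟨m - t * k, ?_⟩
    push_cast
    linear_combination hm - (t : ℚ) * hk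
  · rintro ⟨y₁, hy₁, y₂, hy₂, rfl⟩ z ⟨x₁, hx₁, x₂, hx₂, rfl⟩
    obtain ⟨a, ha⟩ := mem_dualSubmodule_polarBilin.1 (le_dualSubmodule_polarBilin hint hy₁) x₁ hx₁
    obtain ⟨b, hb⟩ := hy₂ x₁ hx₁
    obtain ⟨c, hc⟩ := hx₂ y₁ hy₁
    obtain ⟨d, hd⟩ := exists_natCast_mul_polar_dualLat (by omega) hsub hy₂ hx₂
    rw [QuadraticMap.polar_comm] at hc
    have hd' : (N : F) * ((QuadraticMap.polar Q y₂ x₂ : ℚ) : F) = d := by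
      exact_mod_cast congrArg ((↑) : ℚ → F) hd
    refine ⟨a + n * d, b + c + t * d, ?_⟩
    rw [hpolar, ha, hb, hc, hd']
    push_cast
    ring
end
end

section
/- For all z₁, z₂ in the complex upper half plane ℍ, both of the following series converge absolutely and are equal: Σ_{(x₁,x₂) ∈ L × L^#} exp( 2πi · tr( [[q(x₁), B(x₁,x₂)/2],[B(x₁,x₂)/2, q(x₂)]] · C·diag(z₁,z₂)·ᵀC ) ) = Σ_{y ∈ K} exp( 2πi · ( σ₁(q_F(y))·z₁ + σ₂(q_F(y))·z₂ ) ); that is, the restriction of the degree-2 theta series of (L, q) along the modular embedding equals the Hilbert theta series of the 𝒪_F-lattice K. -/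
open Matrix
open scoped TensorProduct

noncomputable section

/-- The matrix `C` with rows `(1, 1)` and `(σ₁(w), σ₂(w))`. -/
def CmatQ {F : Type*} [Field F] (σ₁ σ₂ : F →+* ℝ) (N : ℕ) (α : F) :
    Matrix (Fin 2) (Fin 2) ℝ :=
  !![1, 1; σ₁ (wQ N α), σ₂ (wQ N α)]

/-- The general term of the restricted degree-2 theta series of `(L, q)`:
`exp(2πi · tr([[q(x₁), B/2],[B/2, q(x₂)]] · C·diag(z₁,z₂)·ᵀC))`. -/
def thetaTerm {F : Type*} [Field F] (σ₁ σ₂ : F →+* ℝ) (N : ℕ) (α : F)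
    {V : Type*} [AddCommGroup V] [Module ℚ V] (Q : QuadraticForm ℚ V)
    (x₁ x₂ : V) (z₁ z₂ : ℂ) : ℂ :=
  Complex.exp (2 * Real.pi * Complex.I *
    Matrix.trace
      (!![((Q x₁ : ℚ) : ℂ), ((QuadraticMap.polar (⇑Q) x₁ x₂ : ℚ) : ℂ) / 2;
          ((QuadraticMap.polar (⇑Q) x₁ x₂ : ℚ) : ℂ) / 2, ((Q x₂ : ℚ) : ℂ)] *
        ((CmatQ σ₁ σ₂ N α).map Complex.ofReal * Matrix.diagonal ![z₁, z₂] *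
          ((CmatQ σ₁ σ₂ N α).map Complex.ofReal)ᵀ)))

/-- The general term of the Hilbert theta series of the `𝒪_F`-lattice `K`:
`exp(2πi · (σ₁(q_F(y))·z₁ + σ₂(q_F(y))·z₂))`. -/
def hilbertTerm {F : Type*} [Field F] [CharZero F] (σ₁ σ₂ : F →+* ℝ)
    {V : Type*} [AddCommGroup V] [Module ℚ V] (Q : QuadraticForm ℚ V)
    (y : F ⊗[ℚ] V) (z₁ z₂ : ℂ) : ℂ :=
  Complex.exp (2 * Real.pi * Complex.I *
    (((σ₁ (Q.baseChange F y) : ℝ) : ℂ) * z₁ + ((σ₂ (Q.baseChange F y) : ℝ) : ℂ) * z₂))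

theorem summable_exp_neg_sum_sq {ι : Type*} [Fintype ι] {c : ℝ} (hc : 0 < c) :
    Summable fun k : ι → ℤ => Real.exp (-c * ∑ i, (k i : ℝ) ^ 2) := by
  classical
  have h1 : Summable fun n : ℤ => Real.exp (-c * (n : ℝ) ^ 2) := by
    have h := summable_pow_mul_jacobiTheta₂_term_bound 0 (div_pos hc Real.pi_pos) 0
    refine h.congr fun n => ?_
    have hpi := Real.pi_ne_zero
    simp only [pow_zero, one_mul]
    congr 1
    field_simp
    ring
  refine summable_of_sum_le (c := ∏ _i : ι, ∑' n : ℤ, Real.exp (-c * (n : ℝ) ^ 2))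
    (fun k => (Real.exp_pos _).le) fun u => ?_
  have hu : u ⊆ Fintype.piFinset fun i => u.image fun k => k i := fun k hk =>
    Fintype.mem_piFinset.2 fun i => Finset.mem_image_of_mem (fun k : ι → ℤ => k i) hk
  calc ∑ k ∈ u, Real.exp (-c * ∑ i, (k i : ℝ) ^ 2)
      ≤ ∑ k ∈ Fintype.piFinset (fun i => u.image fun k : ι → ℤ => k i),
          Real.exp (-c * ∑ i, (k i : ℝ) ^ 2) :=
        Finset.sum_le_sum_of_subset_of_nonneg hu fun _ _ _ => (Real.exp_pos _).le
    _ = ∏ i, ∑ n ∈ u.image (fun k : ι → ℤ => k i), Real.exp (-c * (n : ℝ) ^ 2) := by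
        rw [Finset.prod_univ_sum]
        simp only [Finset.mul_sum, Real.exp_sum]
    _ ≤ _ := Finset.prod_le_prod (fun _ _ => Finset.sum_nonneg fun _ _ => (Real.exp_pos _).le)
        fun _ _ => h1.sum_le_tsum _ fun _ _ => (Real.exp_pos _).le

section QuadraticForm

variable {V : Type*} [AddCommGroup V] [Module ℚ V] {Q : QuadraticForm ℚ V}

theorem QuadraticForm.map_add_smul (Q : QuadraticForm ℚ V) (x y : V) (t : ℚ) :
    Q (x + t • y) = Q x + t * QuadraticMap.polar Q x y + t ^ 2 * Q y := by
  rw [QuadraticMap.map_add Q, QuadraticMap.polar_smul_right, QuadraticMap.map_smul, smul_eq_mul,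
    smul_eq_mul]
  ring

theorem QuadraticMap.PosDef.sq_polar_le (hQ : Q.PosDef) (x y : V) :
    QuadraticMap.polar Q x y ^ 2 ≤ 4 * Q x * Q y := by
  have h := discrim_le_zero (a := Q y) (b := QuadraticMap.polar Q x y) (c := Q x) fun t => by
    have := hQ.nonneg (x + t • y)
    rw [QuadraticForm.map_add_smul] at this
    linarith
  rw [discrim] at h
  linarith

/-- The Cauchy–Schwarz inequality makes the real extension of `Q` positive semidefinite. -/
theorem QuadraticMap.PosDef.real_quadratic_nonneg (hQ : Q.PosDef) (x y : V) (s : ℝ) :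
    0 ≤ (Q x : ℝ) + s * (QuadraticMap.polar Q x y : ℚ) + s ^ 2 * (Q y : ℝ) := by
  have h : ((QuadraticMap.polar Q x y : ℚ) : ℝ) ^ 2 ≤ 4 * (Q x : ℝ) * (Q y : ℝ) :=
    mod_cast hQ.sq_polar_le x y
  have hx : (0 : ℝ) ≤ Q x := mod_cast hQ.nonneg x
  have hy : (0 : ℝ) ≤ Q y := mod_cast hQ.nonneg y
  rcases hy.eq_or_lt with hy0 | hy0
  · rw [← hy0] at h ⊢
    have : ((QuadraticMap.polar Q x y : ℚ) : ℝ) = 0 := by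
      refine pow_eq_zero_iff two_ne_zero |>.1 (le_antisymm ?_ (sq_nonneg _))
      linarith
    rw [this]
    linarith
  · refine nonneg_of_mul_nonneg_right (a := 4 * (Q y : ℝ)) ?_ (by positivity)
    nlinarith [sq_nonneg (2 * (Q y : ℝ) * s + (QuadraticMap.polar Q x y : ℚ))]

theorem subset_dualLat {L : Submodule ℤ V} (hint : ∀ x ∈ L, ∃ m : ℤ, Q x = (m : ℚ)) :
    (L : Set V) ⊆ dualLat Q L := by
  intro x hx e he
  obtain ⟨a, ha⟩ := hint _ (L.add_mem hx he)
  obtain ⟨b, hb⟩ := hint _ hx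
  obtain ⟨c, hc⟩ := hint _ he
  exact ⟨a - b - c, by rw [QuadraticMap.polar, ha, hb, hc]; push_cast; rfl⟩

/-- The theta series of the dual of a full lattice converges: pairing with a basis contained in
the lattice embeds the dual lattice into some `ℤⁿ`. -/
theorem summable_exp_neg_dualLat [FiniteDimensional ℚ V] (hQ : Q.PosDef) {L : Submodule ℤ V}
    (hfull : Submodule.span ℚ (L : Set V) = ⊤) {c : ℝ} (hc : 0 < c) :
    Summable fun x : dualLat Q L => Real.exp (-c * (Q (x : V) : ℝ)) := by
  let b := Module.Basis.ofSpan hfull.ge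
  have hb : ∀ i, b i ∈ L := fun i => Module.Basis.ofSpan_subset hfull.ge ⟨i, rfl⟩
  have := Module.Finite.finite_basis b
  let _ := Fintype.ofFinite ((linearIndepOn_empty ℚ (id : V → V)).extend
    (Set.empty_subset (L : Set V)))
  choose f hf using fun (x : dualLat Q L) i => x.2 (b i) (hb i)
  have hinj : Function.Injective f := by
    intro x y hxy
    have hz : ∀ v, QuadraticMap.polarBilin Q ((x : V) - y) v = 0 := fun v => by
      have : QuadraticMap.polarBilin Q ((x : V) - y) = 0 := b.ext fun i => by
        rw [map_sub, LinearMap.sub_apply, QuadraticMap.polarBilin_apply_apply,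
          QuadraticMap.polarBilin_apply_apply, hf, hf, hxy, sub_self, LinearMap.zero_apply]
      rw [this, LinearMap.zero_apply]
    have h0 := hz ((x : V) - y)
    rw [QuadraticMap.polarBilin_apply_apply, QuadraticMap.polar_self] at h0
    have h1 : Q ((x : V) - y) = 0 := by simpa using h0
    exact Subtype.ext (sub_eq_zero.1 (hQ.anisotropic _ h1))
  set M : ℝ := 4 * ∑ i, (Q (b i) : ℝ) + 1
  have hM : 0 < M := by
    have : 0 ≤ ∑ i, (Q (b i) : ℝ) := Finset.sum_nonneg fun i _ => mod_cast hQ.nonneg (b i)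
    positivity
  refine Summable.of_nonneg_of_le (fun _ => (Real.exp_pos _).le) (fun x => ?_)
    ((summable_exp_neg_sum_sq (div_pos hc hM)).comp_injective hinj)
  have hx : (0 : ℝ) ≤ Q (x : V) := mod_cast hQ.nonneg (x : V)
  have key : ∑ i, (f x i : ℝ) ^ 2 ≤ M * Q (x : V) := by
    have : ∑ i, (f x i : ℝ) ^ 2 ≤ ∑ i, 4 * (Q (x : V) : ℝ) * Q (b i) :=
      Finset.sum_le_sum fun i _ => by
        have h := hQ.sq_polar_le (x : V) (b i)
        rw [hf] at h
        exact_mod_cast h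
    rw [← Finset.mul_sum] at this
    simp only [M]
    linarith
  refine Real.exp_le_exp.2 ?_
  calc -c * (Q (x : V) : ℝ) = -(c / M * (M * Q (x : V))) := by field_simp
    _ ≤ -(c / M * ∑ i, (f x i : ℝ) ^ 2) := by gcongr
    _ = _ := by ring

end QuadraticForm

section Hilbert

variable {F : Type*} [Field F] {N : ℕ} {α : F} {σ₁ σ₂ : F →+* ℝ}

theorem discN_pos (hN : 1 < N) : 0 < discN N := by
  unfold discN; split_ifs <;> omega

/-- The two conjugates of `w` are `(Δ ± √Δ)/2`. -/
theorem exists_map_wQ (hσ₁ : σ₁ α = Real.sqrt N) (hσ₂ : σ₂ α = -Real.sqrt N) :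
    ∃ d : ℝ, d ^ 2 = (discN N : ℝ) / 4 ∧ σ₁ (wQ N α) = (discN N : ℝ) / 2 + d ∧
      σ₂ (wQ N α) = (discN N : ℝ) / 2 - d := by
  have hs : Real.sqrt N ^ 2 = N := Real.sq_sqrt N.cast_nonneg
  by_cases h : N % 4 = 1
  · refine ⟨Real.sqrt N / 2, ?_, ?_, ?_⟩ <;>
      simp only [wQ, sqrtDisc, discN, h, if_true, map_div₀, map_add, map_natCast, map_ofNat, hσ₁,
        hσ₂, div_pow, hs] <;> ring
  · refine ⟨Real.sqrt N, ?_, ?_, ?_⟩ <;>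
      simp only [wQ, sqrtDisc, discN, h, if_false, map_div₀, map_add, map_mul, map_natCast,
        map_ofNat, hσ₁, hσ₂, hs] <;> push_cast <;> ring

variable [CharZero F] {V : Type*} [AddCommGroup V] [Module ℚ V]

theorem map_baseChange_add_tmul (σ : F →+* ℝ) (Q : QuadraticForm ℚ V) (w : F) (x y : V) :
    σ (Q.baseChange F ((1 : F) ⊗ₜ[ℚ] x + w ⊗ₜ[ℚ] y)) =
      (Q x : ℝ) + σ w * (QuadraticMap.polar Q x y : ℚ) + σ w ^ 2 * (Q y : ℝ) := by
  rw [QuadraticMap.map_add (Q.baseChange F), ← QuadraticMap.polarBilin_apply_apply,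
    QuadraticForm.polarBilin_baseChange, QuadraticForm.baseChange_tmul,
    QuadraticForm.baseChange_tmul, LinearMap.BilinForm.baseChange_tmul]
  simp only [map_add, QuadraticMap.polarBilin_apply_apply, Rat.smul_def, map_mul, map_one,
    map_ratCast]
  ring

theorem thetaTerm_eq_hilbertTerm (Q : QuadraticForm ℚ V) (x y : V) (z₁ z₂ : ℂ) :
    thetaTerm σ₁ σ₂ N α Q x y z₁ z₂ =
      hilbertTerm σ₁ σ₂ Q ((1 : F) ⊗ₜ[ℚ] x + wQ N α ⊗ₜ[ℚ] y) z₁ z₂ := by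
  unfold thetaTerm hilbertTerm
  rw [map_baseChange_add_tmul, map_baseChange_add_tmul]
  congr 2
  simp only [CmatQ, Matrix.trace_fin_two, Matrix.mul_apply, Fin.sum_univ_two, Matrix.map_apply,
    Matrix.transpose_apply, Matrix.diagonal_apply, Matrix.of_apply, Matrix.cons_val_zero,
    Matrix.cons_val_one, Matrix.cons_val', Matrix.cons_val_fin_one]
  simp
  ring

/-- The sum of the conjugates of `q_F(x + w y)`, after completing the square. -/
theorem map_add_map_baseChange (hσ₁ : σ₁ α = Real.sqrt N) (hσ₂ : σ₂ α = -Real.sqrt N)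
    (Q : QuadraticForm ℚ V) (x y : V) :
    σ₁ (Q.baseChange F ((1 : F) ⊗ₜ[ℚ] x + wQ N α ⊗ₜ[ℚ] y)) +
      σ₂ (Q.baseChange F ((1 : F) ⊗ₜ[ℚ] x + wQ N α ⊗ₜ[ℚ] y)) =
      2 * (Q (x + ((discN N : ℚ) / 2) • y) : ℝ) + discN N / 2 * (Q y : ℝ) := by
  obtain ⟨d, hd, h₁, h₂⟩ := exists_map_wQ (N := N) hσ₁ hσ₂
  rw [map_baseChange_add_tmul, map_baseChange_add_tmul, h₁, h₂, QuadraticForm.map_add_smul]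
  push_cast
  linear_combination 2 * (Q y : ℝ) * hd

theorem norm_hilbertTerm (Q : QuadraticForm ℚ V) (y : F ⊗[ℚ] V) (z₁ z₂ : ℂ) :
    ‖hilbertTerm σ₁ σ₂ Q y z₁ z₂‖ = Real.exp (-(2 * Real.pi *
      (σ₁ (Q.baseChange F y) * z₁.im + σ₂ (Q.baseChange F y) * z₂.im))) := by
  rw [hilbertTerm, Complex.norm_exp]
  congr 1
  simp

theorem tmul_add_tmul_injective (hN : 1 < N) (hσ₁ : σ₁ α = Real.sqrt N)
    (hσ₂ : σ₂ α = -Real.sqrt N) {Q : QuadraticForm ℚ V} (hQ : Q.PosDef) :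
    Function.Injective fun p : V × V => (1 : F) ⊗ₜ[ℚ] p.1 + wQ N α ⊗ₜ[ℚ] p.2 := by
  rintro ⟨x, y⟩ ⟨x', y'⟩ h
  have h0 : (1 : F) ⊗ₜ[ℚ] (x - x') + wQ N α ⊗ₜ[ℚ] (y - y') = 0 := by
    rw [TensorProduct.tmul_sub, TensorProduct.tmul_sub, ← add_sub_add_comm]
    exact sub_eq_zero.2 h
  have h1 := map_add_map_baseChange hσ₁ hσ₂ Q (x - x') (y - y')
  rw [h0, QuadraticMap.map_zero, map_zero, map_zero, add_zero] at h1
  have hΔ : (0 : ℝ) < discN N := mod_cast discN_pos hN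
  have ha : (0 : ℝ) ≤ Q (x - x' + ((discN N : ℚ) / 2) • (y - y')) := mod_cast hQ.nonneg _
  have hb : (0 : ℝ) ≤ Q (y - y') := mod_cast hQ.nonneg _
  have hy : (Q (y - y') : ℝ) = 0 := by
    by_contra hne
    have := mul_pos (half_pos hΔ) (hb.lt_of_ne' hne)
    linarith
  have hy' : y - y' = 0 := hQ.anisotropic _ (mod_cast hy)
  have hx : (Q (x - x' + ((discN N : ℚ) / 2) • (y - y')) : ℝ) = 0 := by
    rw [hy] at h1
    linarith
  rw [hy', smul_zero, add_zero] at hx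
  exact Prod.ext (sub_eq_zero.1 (hQ.anisotropic _ (mod_cast hx))) (sub_eq_zero.1 hy')

theorem exists_mul_le_conjugate_sum (hN : 1 < N) (hσ₁ : σ₁ α = Real.sqrt N)
    (hσ₂ : σ₂ α = -Real.sqrt N) {Q : QuadraticForm ℚ V} (hQ : Q.PosDef) {t₁ t₂ : ℝ}
    (ht₁ : 0 < t₁) (ht₂ : 0 < t₂) :
    ∃ c : ℝ, 0 < c ∧ ∀ x y : V, c * ((Q x : ℝ) + (Q y : ℝ)) ≤
      σ₁ (Q.baseChange F ((1 : F) ⊗ₜ[ℚ] x + wQ N α ⊗ₜ[ℚ] y)) * t₁ +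
      σ₂ (Q.baseChange F ((1 : F) ⊗ₜ[ℚ] x + wQ N α ⊗ₜ[ℚ] y)) * t₂ := by
  have hΔ : (1 : ℝ) ≤ discN N := mod_cast discN_pos hN
  have ht : 0 < min t₁ t₂ := lt_min ht₁ ht₂
  refine ⟨min t₁ t₂ / (2 * (discN N + 1)), by positivity, fun x y => ?_⟩
  have hsum := map_add_map_baseChange hσ₁ hσ₂ Q x y
  have hn : ∀ σ : F →+* ℝ, 0 ≤ σ (Q.baseChange F ((1 : F) ⊗ₜ[ℚ] x + wQ N α ⊗ₜ[ℚ] y)) := fun σ => by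
    rw [map_baseChange_add_tmul]
    exact hQ.real_quadratic_nonneg x y _
  have hn₁ := hn σ₁
  have hn₂ := hn σ₂
  set A := σ₁ (Q.baseChange F ((1 : F) ⊗ₜ[ℚ] x + wQ N α ⊗ₜ[ℚ] y))
  set B := σ₂ (Q.baseChange F ((1 : F) ⊗ₜ[ℚ] x + wQ N α ⊗ₜ[ℚ] y))
  have hpar : (0 : ℝ) ≤ Q (x + (discN N : ℚ) • y) := mod_cast hQ.nonneg _
  have hs : (0 : ℝ) ≤ Q (x + ((discN N : ℚ) / 2) • y) := mod_cast hQ.nonneg _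
  have hy : (0 : ℝ) ≤ Q y := mod_cast hQ.nonneg _
  have hbound : (Q x : ℝ) + Q y ≤ 2 * (discN N + 1) * (A + B) := by
    rw [hsum]
    rw [QuadraticForm.map_add_smul] at hpar hs ⊢
    push_cast at hpar hs ⊢
    nlinarith [mul_nonneg (sub_nonneg.2 hΔ) hs, mul_nonneg (sub_nonneg.2 hΔ) hy]
  calc min t₁ t₂ / (2 * (discN N + 1)) * ((Q x : ℝ) + (Q y : ℝ))
      ≤ min t₁ t₂ / (2 * (discN N + 1)) * (2 * (discN N + 1) * (A + B)) := by gcongr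
    _ = A * min t₁ t₂ + B * min t₁ t₂ := by field_simp
    _ ≤ A * t₁ + B * t₂ := by
      gcongr
      · exact min_le_left _ _
      · exact min_le_right _ _

/-- The parametrization `(x₁, x₂) ↦ x₁ + w x₂` of the lattice `K` by `L × L^#`. -/
def KlatEquiv (hN : 1 < N) (hσ₁ : σ₁ α = Real.sqrt N) (hσ₂ : σ₂ α = -Real.sqrt N)
    {Q : QuadraticForm ℚ V} (hQ : Q.PosDef) (L : Submodule ℤ V) :
    L × dualLat Q L ≃ Klat N α Q L :=
  Equiv.ofBijective
    (fun p => ⟨(1 : F) ⊗ₜ[ℚ] (p.1 : V) + wQ N α ⊗ₜ[ℚ] (p.2 : V), p.1, p.1.2, p.2, p.2.2, rfl⟩) <| by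
    refine ⟨fun p p' h => ?_, ?_⟩
    · have h' := tmul_add_tmul_injective hN hσ₁ hσ₂ hQ
        (a₁ := ((p.1 : V), (p.2 : V))) (a₂ := ((p'.1 : V), (p'.2 : V))) (Subtype.ext_iff.1 h)
      exact Prod.ext (Subtype.ext (Prod.ext_iff.1 h').1) (Subtype.ext (Prod.ext_iff.1 h').2)
    · rintro ⟨_, x, hx, y, hy, rfl⟩
      exact ⟨(⟨x, hx⟩, ⟨y, hy⟩), rfl⟩

end Hilbert

/-- For `z₁, z₂ ∈ ℍ`, both the restriction of the degree-2 theta series of `(L, q)`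
along the modular embedding (summed over `L × L^#`) and the Hilbert theta series of
the `𝒪_F`-lattice `K` converge absolutely, and they are equal. -/
theorem stmt14 {F : Type*} [Field F] [CharZero F] (N : ℕ) (hN : 1 < N)
    (hsf : Squarefree N) (α : F) (hα : α ^ 2 = (N : F))
    (hgen : ∀ x : F, ∃ p q : ℚ, x = (p : F) + (q : F) * α)
    (σ₁ σ₂ : F →+* ℝ) (hσ₁ : σ₁ α = Real.sqrt N) (hσ₂ : σ₂ α = -Real.sqrt N)
    {V : Type*} [AddCommGroup V] [Module ℚ V] [FiniteDimensional ℚ V]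
    (Q : QuadraticForm ℚ V) (hQpos : QuadraticMap.PosDef Q)
    (L : Submodule ℤ V) (hfull : Submodule.span ℚ (L : Set V) = ⊤)
    (hint : ∀ x ∈ L, ∃ m : ℤ, Q x = (m : ℚ))
    (hNdual : ∀ y ∈ dualLat Q L, ∃ m : ℤ, (N : ℚ) * Q y = (m : ℚ))
    (hsub : ∀ y ∈ dualLat Q L, ∃ x ∈ L, y = (N : ℚ)⁻¹ • x)
    (z₁ z₂ : ℂ) (hz₁ : 0 < z₁.im) (hz₂ : 0 < z₂.im) :
    Summable (fun p : L × dualLat Q L =>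
      ‖thetaTerm σ₁ σ₂ N α Q (p.1 : V) (p.2 : V) z₁ z₂‖) ∧
    Summable (fun y : Klat N α Q L => ‖hilbertTerm σ₁ σ₂ Q (y : F ⊗[ℚ] V) z₁ z₂‖) ∧
    ∑' p : L × dualLat Q L, thetaTerm σ₁ σ₂ N α Q (p.1 : V) (p.2 : V) z₁ z₂ =
      ∑' y : Klat N α Q L, hilbertTerm σ₁ σ₂ Q (y : F ⊗[ℚ] V) z₁ z₂ := by
  have hterm : ∀ p : L × dualLat Q L,
      thetaTerm σ₁ σ₂ N α Q (p.1 : V) (p.2 : V) z₁ z₂ =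
        hilbertTerm σ₁ σ₂ Q (KlatEquiv hN hσ₁ hσ₂ hQpos L p : F ⊗[ℚ] V) z₁ z₂ := fun p =>
    thetaTerm_eq_hilbertTerm Q _ _ _ _
  have hsum : Summable (fun p : L × dualLat Q L =>
      ‖thetaTerm σ₁ σ₂ N α Q (p.1 : V) (p.2 : V) z₁ z₂‖) := by
    obtain ⟨c, hc, hle⟩ := exists_mul_le_conjugate_sum hN hσ₁ hσ₂ hQpos hz₁ hz₂
    have hdual := summable_exp_neg_dualLat hQpos hfull (mul_pos Real.two_pi_pos hc)
    have hL := hdual.comp_injective (Set.inclusion_injective (subset_dualLat hint))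
    refine Summable.of_nonneg_of_le (fun _ => norm_nonneg _) (fun p => ?_)
      (hL.mul_of_nonneg hdual (fun _ => (Real.exp_pos _).le) fun _ => (Real.exp_pos _).le)
    rw [thetaTerm_eq_hilbertTerm, norm_hilbertTerm]
    simp only [Function.comp_apply]
    rw [← Real.exp_add]
    refine Real.exp_le_exp.2 ?_
    have := mul_le_mul_of_nonneg_left (hle p.1 p.2) Real.two_pi_pos.le
    linarith
  refine ⟨hsum, ?_, ?_⟩
  · refine (KlatEquiv hN hσ₁ hσ₂ hQpos L).summable_iff.1 (hsum.congr fun p => ?_)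
    rw [hterm, Function.comp_apply]
  · rw [← (KlatEquiv hN hσ₁ hσ₂ hQpos L).tsum_eq]
    exact tsum_congr hterm
end
end
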